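/- Let {(~μ_t, μ_t) : t ≥ 0} be a two-state free convolution semigroup with finite variances, canonical triple (β, γ, ρ) for {μ_t} (γ > 0) and relative canonical triple (~β, ~γ, ~ρ) (~γ > 0). Set ν_t = J[μ_t] and ~ν_t = J[~μ_t]. Then for every z ∈ ℂ ∖ ℝ and f(x) = 1/(z−x), writing ∂f(x,y) = (f(x)−f(y))/(x−y) for the difference quotient and ∂²f(x,y,w) for the iterated difference quotient, one has d/dt ∫ f d~μ_t = ~γ ∭ ∂²f(x,y,w) d~μ_t(x) d~μ_t(y) d~ν_t(w) − γ ∭ ∂²f(x,y,w) d~μ_t(x) d~μ_t(y) dν_t(w) + (~β − β) ∬ ∂f(x,y) d~μ_t(x) d~μ_t(y) + γ ∬ ∂_x[∂f(x,w)] d~μ_t(x) dν_t(w) + β ∫ f′ d~μ_t, and d/dt ∫ f dμ_t = γ ∬ ∂_x[∂f(x,w)] dμ_t(x) dν_t(w) + β ∫ f′ dμ_t. -/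

import Mathlib

open MeasureTheory Complex

noncomputable section

/-- The Cauchy transform `G_μ(z) = ∫ 1/(z - x) dμ(x)` of a measure on `ℝ`. -/
def cauchyG (μ : Measure ℝ) (z : ℂ) : ℂ := ∫ x : ℝ, (z - (x : ℂ))⁻¹ ∂μ

/-- The F-transform `F_μ = 1/G_μ`. -/
def Ftr (μ : Measure ℝ) (z : ℂ) : ℂ := (cauchyG μ z)⁻¹

/-- The open upper half-plane `ℂ⁺`. -/
def UHP : Set ℂ := {z : ℂ | 0 < z.im}

/-- The truncated cone `Γ_{α,M} = {z ∈ ℂ⁺ : |Re z| < α · Im z, Im z > M}`. -/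
def tcone (α M : ℝ) : Set ℂ := {z : ℂ | |z.re| < α * z.im ∧ M < z.im}

/-- `φ` is a Voiculescu transform of `μ`: `φ(F_μ(z)) + F_μ(z) = z` on some truncated cone. -/
def IsVT (μ : Measure ℝ) (φ : ℂ → ℂ) : Prop :=
  ∃ α M : ℝ, 0 < α ∧ 0 < M ∧ ∀ z ∈ tcone α M, φ (Ftr μ z) + Ftr μ z = z

/-- `ψ` is a two-state Voiculescu transform of the pair `(μt, μ)`:
`ψ(F_μ(z)) + F_{μt}(z) = z` on some truncated cone. -/
def IsTwoStateVT (μt μ : Measure ℝ) (ψ : ℂ → ℂ) : Prop :=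
  ∃ α M : ℝ, 0 < α ∧ 0 < M ∧ ∀ z ∈ tcone α M, ψ (Ftr μ z) + Ftr μt z = z

/-- `μ` is freely infinitely divisible: some Voiculescu transform `φ` of `μ` is such that
`t·φ` is a Voiculescu transform of a probability measure for every `t ≥ 0`. -/
def IsFID (μ : Measure ℝ) : Prop :=
  ∃ φ : ℂ → ℂ, IsVT μ φ ∧ ∀ t : ℝ, 0 ≤ t →
    ∃ ν : Measure ℝ, IsProbabilityMeasure ν ∧ IsVT ν (fun z => (t : ℂ) * φ z)

/-- The semicircular distribution with mean `β` and variance `γ` (Dirac mass at `β` for `γ = 0`). -/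
def semicircle (β γ : ℝ) : Measure ℝ :=
  if γ = 0 then Measure.dirac β
  else volume.withDensity
    (fun x => ENNReal.ofReal ((2 * Real.pi * γ)⁻¹ * Real.sqrt (4 * γ - (x - β) ^ 2)))

open Filter Topology ComplexConjugate

lemma sub_ofReal_ne_zero {z : ℂ} (hz : z.im ≠ 0) (x : ℝ) : z - (x : ℂ) ≠ 0 := by
  intro h
  apply hz
  simpa using congrArg Complex.im h

lemma norm_inv_sub_ofReal_le {z : ℂ} (hz : 0 < z.im) (x : ℝ) :
    ‖(z - (x : ℂ))⁻¹‖ ≤ (z.im)⁻¹ := by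
  rw [norm_inv]
  apply inv_anti₀ hz
  have h := Complex.abs_im_le_norm (z - (x : ℂ))
  simp only [sub_im, ofReal_im, sub_zero] at h
  exact (le_abs_self _).trans h

lemma continuous_inv_sub_ofReal {z : ℂ} (hz : z.im ≠ 0) :
    Continuous fun x : ℝ => (z - (x : ℂ))⁻¹ :=
  (by fun_prop : Continuous fun x : ℝ => z - (x : ℂ)).inv₀ (sub_ofReal_ne_zero hz)

lemma integrable_inv_sub_ofReal (μ : Measure ℝ) [IsFiniteMeasure μ] {z : ℂ} (hz : 0 < z.im) :
    Integrable (fun x : ℝ => (z - (x : ℂ))⁻¹) μ :=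
  Integrable.of_bound (continuous_inv_sub_ofReal hz.ne').aestronglyMeasurable (z.im)⁻¹
    (.of_forall (norm_inv_sub_ofReal_le hz))

lemma integrable_norm_inv_sub_ofReal_sq (μ : Measure ℝ) [IsFiniteMeasure μ] {z : ℂ}
    (hz : 0 < z.im) : Integrable (fun x : ℝ => ‖(z - (x : ℂ))⁻¹‖ ^ 2) μ := by
  refine Integrable.of_bound
    ((continuous_inv_sub_ofReal hz.ne').norm.pow 2).aestronglyMeasurable ((z.im)⁻¹ ^ 2)
    (.of_forall fun x => ?_)
  rw [norm_pow, norm_norm]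
  gcongr
  exact norm_inv_sub_ofReal_le hz x

lemma hasDerivAt_cauchyG (μ : Measure ℝ) [IsFiniteMeasure μ] {z : ℂ} (hz : 0 < z.im) :
    HasDerivAt (cauchyG μ) (-∫ x : ℝ, ((z - (x : ℂ)) ^ 2)⁻¹ ∂μ) z := by
  have him : ∀ w ∈ Metric.ball z (z.im / 2), z.im / 2 < w.im := by
    intro w hw
    rw [Metric.mem_ball, dist_eq_norm] at hw
    have h := (abs_le.1 (Complex.abs_im_le_norm (w - z))).1
    simp only [sub_im] at h
    linarith
  rw [← integral_neg]
  refine (hasDerivAt_integral_of_dominated_loc_of_deriv_le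
    (F := fun (w : ℂ) (x : ℝ) => (w - (x : ℂ))⁻¹)
    (F' := fun (w : ℂ) (x : ℝ) => -((w - (x : ℂ)) ^ 2)⁻¹)
    (bound := fun _ => (z.im / 2)⁻¹ ^ 2)
    (Metric.ball_mem_nhds z (half_pos hz)) ?_ (integrable_inv_sub_ofReal μ hz) ?_ ?_
    (integrable_const _) ?_).2
  · filter_upwards [Metric.ball_mem_nhds z (half_pos hz)] with w hw
    exact (continuous_inv_sub_ofReal
      ((half_pos hz).trans (him w hw)).ne').aestronglyMeasurable
  · simp only [← inv_pow]
    exact ((continuous_inv_sub_ofReal hz.ne').pow 2).neg.aestronglyMeasurable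
  · refine .of_forall fun x w hw => ?_
    rw [norm_neg, ← inv_pow, norm_pow]
    gcongr
    exact (norm_inv_sub_ofReal_le ((half_pos hz).trans (him w hw)) x).trans
      (inv_anti₀ (half_pos hz) (him w hw).le)
  · refine .of_forall fun x w hw => ?_
    have hne := sub_ofReal_ne_zero ((half_pos hz).trans (him w hw)).ne' x
    simpa [neg_div] using ((hasDerivAt_id w).sub_const (x : ℂ)).fun_inv hne

lemma norm_cauchyG_le (μ : Measure ℝ) [IsProbabilityMeasure μ] {z : ℂ} (hz : 0 < z.im) :
    ‖cauchyG μ z‖ ≤ (z.im)⁻¹ := by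
  simpa [cauchyG] using norm_integral_le_of_norm_le_const (μ := μ)
    (.of_forall (norm_inv_sub_ofReal_le hz))

lemma cauchyG_im (μ : Measure ℝ) [IsFiniteMeasure μ] {z : ℂ} (hz : 0 < z.im) :
    (cauchyG μ z).im = -(z.im * ∫ x : ℝ, ‖(z - (x : ℂ))⁻¹‖ ^ 2 ∂μ) := by
  rw [cauchyG, ← integral_const_mul, ← integral_neg]
  refine (integral_im (integrable_inv_sub_ofReal μ hz)).symm.trans (integral_congr_ae
    (.of_forall fun x => ?_))
  simp [Complex.normSq_eq_norm_sq]
  ring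

lemma norm_cauchyG_sub_le (μ : Measure ℝ) [IsFiniteMeasure μ] {z w : ℂ} (hz : 0 < z.im)
    (hw : 0 < w.im) :
    ‖cauchyG μ z - cauchyG μ w‖ ≤ ‖z - w‖ * (((∫ x : ℝ, ‖(z - (x : ℂ))⁻¹‖ ^ 2 ∂μ) +
      ∫ x : ℝ, ‖(w - (x : ℂ))⁻¹‖ ^ 2 ∂μ) / 2) := by
  rw [cauchyG, cauchyG, ← integral_sub (integrable_inv_sub_ofReal μ hz)
    (integrable_inv_sub_ofReal μ hw), ← integral_add (integrable_norm_inv_sub_ofReal_sq μ hz)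
    (integrable_norm_inv_sub_ofReal_sq μ hw), ← integral_div, ← integral_const_mul]
  refine norm_integral_le_of_norm_le ((((integrable_norm_inv_sub_ofReal_sq μ hz).add
    (integrable_norm_inv_sub_ofReal_sq μ hw)).div_const 2).const_mul _) (.of_forall fun x => ?_)
  have h1 := sub_ofReal_ne_zero hz.ne' x
  have h2 := sub_ofReal_ne_zero hw.ne' x
  have h : (z - (x : ℂ))⁻¹ - (w - (x : ℂ))⁻¹ =
      -(z - w) * ((z - (x : ℂ))⁻¹ * (w - (x : ℂ))⁻¹) := by
    field_simp
    ring
  rw [h, norm_mul, norm_neg, norm_mul]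
  gcongr
  nlinarith [sq_nonneg (‖(z - (x : ℂ))⁻¹‖ - ‖(w - (x : ℂ))⁻¹‖)]

lemma cauchyG_conj (μ : Measure ℝ) (z : ℂ) : cauchyG μ (conj z) = conj (cauchyG μ z) := by
  rw [cauchyG, cauchyG, ← integral_conj]
  simp

lemma isOpen_UHP : IsOpen UHP := isOpen_lt continuous_const Complex.continuous_im

lemma convex_UHP : Convex ℝ UHP := convex_halfSpace_im_gt 0

lemma eqOn_UHP_of_eqOn_tcone {f g : ℂ → ℂ} (hf : DifferentiableOn ℂ f UHP)
    (hg : DifferentiableOn ℂ g UHP) {α M : ℝ} (hα : 0 < α) (hM : 0 < M)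
    (h : Set.EqOn f g (tcone α M)) : Set.EqOn f g UHP := by
  have hopen : IsOpen (tcone α M) :=
    (isOpen_lt (f := fun z : ℂ => |z.re|) (g := fun z : ℂ => α * z.im)
      Complex.continuous_re.abs (Complex.continuous_im.const_mul α)).inter
      (isOpen_lt continuous_const Complex.continuous_im)
  have hmem : (⟨0, M + 1⟩ : ℂ) ∈ tcone α M := by
    refine ⟨?_, ?_⟩
    · simp only [abs_zero]; positivity
    · simp
  refine (hf.analyticOnNhd isOpen_UHP).eqOn_of_preconnected_of_eventuallyEq
    (hg.analyticOnNhd isOpen_UHP) convex_UHP.isPreconnected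
    (z₀ := ⟨0, M + 1⟩) (by change 0 < M + 1; positivity) ?_
  filter_upwards [hopen.mem_nhds hmem] with z hz using h hz

/-- A curve solving `w s + β s + γ s G_ρ(w s) = z` near `s = t` is differentiable at `t`. -/
lemma hasDerivAt_of_subordination (ρ : Measure ℝ) [IsProbabilityMeasure ρ] {β γ t : ℝ}
    (hγ : 0 < γ) (ht : 0 < t) {z : ℂ} (hz : 0 < z.im) {w : ℝ → ℂ}
    (hwim : ∀ s, 0 < s → z.im ≤ (w s).im)
    (hw : ∀ s, 0 < s → w s = z - ((β * s : ℝ) : ℂ) - ((γ * s : ℝ) : ℂ) * cauchyG ρ (w s))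
    {d : ℂ} (hd : d * (1 - γ * t * ∫ x : ℝ, ((w t - (x : ℂ)) ^ 2)⁻¹ ∂ρ) = 1) :
    HasDerivAt w (-(β + γ * cauchyG ρ (w t)) * d) t := by
  set I : ℝ → ℝ := fun s => ∫ x : ℝ, ‖(w s - (x : ℂ))⁻¹‖ ^ 2 ∂ρ with hI
  have hpos : ∀ s, 0 < s → 0 < (w s).im := fun s hs => hz.trans_le (hwim s hs)
  have hIeq : ∀ s, 0 < s → γ * s * I s = 1 - z.im / (w s).im := by
    intro s hs
    have h := congrArg Complex.im (hw s hs)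
    rw [sub_im, sub_im, ofReal_im, im_ofReal_mul, cauchyG_im ρ (hpos s hs)] at h
    have := (hpos s hs).ne'
    have h' : (w s).im = z.im - 0 - γ * s * -((w s).im * I s) := h
    field_simp
    linarith
  have hdiff : ∀ s, 0 < s → (w s - w t) + γ * t * (cauchyG ρ (w s) - cauchyG ρ (w t)) =
      -((s - t : ℝ) : ℂ) * (β + γ * cauchyG ρ (w s)) := by
    intro s hs
    have h1 := hw s hs
    have h2 := hw t ht
    push_cast at h1 h2 ⊢
    linear_combination h1 - h2
  set δ : ℝ := z.im / (w t).im with hδ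
  have hδ0 : 0 < δ := div_pos hz (hpos t ht)
  set C : ℝ := |β| + γ * (z.im)⁻¹ with hC
  have hbound : ∀ᶠ s in 𝓝 t, ‖w s - w t‖ ≤ C * |s - t| / (δ / 4) := by
    have hlim : Tendsto (fun s : ℝ => t / s) (𝓝 t) (𝓝 1) := by
      have h : ContinuousAt (fun s : ℝ => t / s) t := by
        apply ContinuousAt.div <;> first | fun_prop | exact ht.ne'
      simpa [ContinuousAt, div_self ht.ne'] using h
    filter_upwards [lt_mem_nhds ht, hlim.eventually_lt_const
      (by linarith : (1 : ℝ) < 1 + δ / 2)] with s hs hts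
    have h1 := norm_cauchyG_sub_le ρ (hpos s hs) (hpos t ht)
    change _ ≤ ‖w s - w t‖ * ((I s + I t) / 2) at h1
    have h2 : γ * t * I s ≤ 1 + δ / 2 := by
      have h3 : γ * s * I s ≤ 1 := by
        rw [hIeq s hs]
        have := div_pos hz (hpos s hs)
        linarith
      calc γ * t * I s = t / s * (γ * s * I s) := by field_simp
        _ ≤ t / s * 1 := by gcongr
        _ ≤ 1 + δ / 2 := by linarith
    have h3 := hIeq t ht
    have h4 : ‖(w s - w t)‖ ≤ C * |s - t| +
        γ * t * ‖cauchyG ρ (w s) - cauchyG ρ (w t)‖ := by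
      have h5 : w s - w t = -((s - t : ℝ) : ℂ) * (β + γ * cauchyG ρ (w s)) -
          γ * t * (cauchyG ρ (w s) - cauchyG ρ (w t)) := by
        rw [← hdiff s hs]; ring
      have h6 : ‖(β : ℂ) + γ * cauchyG ρ (w s)‖ ≤ C := by
        refine (norm_add_le _ _).trans ?_
        rw [norm_mul, norm_real, norm_real, Real.norm_eq_abs, Real.norm_of_nonneg hγ.le, hC]
        gcongr
        exact (norm_cauchyG_le ρ (hpos s hs)).trans (inv_anti₀ hz (hwim s hs))
      rw [h5]
      refine (norm_sub_le _ _).trans ?_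
      rw [norm_mul, norm_neg, norm_mul, norm_mul, norm_real, norm_real, norm_real,
        Real.norm_of_nonneg hγ.le, Real.norm_of_nonneg ht.le, Real.norm_eq_abs, mul_comm C]
      gcongr
    rw [le_div_iff₀ (by positivity)]
    have h7 : γ * t * ‖cauchyG ρ (w s) - cauchyG ρ (w t)‖ ≤ ‖w s - w t‖ * (1 - δ / 4) := by
      calc _ ≤ γ * t * (‖w s - w t‖ * ((I s + I t) / 2)) := by gcongr
        _ = ‖w s - w t‖ * ((γ * t * I s + γ * t * I t) / 2) := by ring
        _ ≤ _ := by
          gcongr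
          rw [h3]
          linarith
    linarith
  have hcont : Tendsto w (𝓝 t) (𝓝 (w t)) := by
    rw [tendsto_iff_norm_sub_tendsto_zero]
    have h : Tendsto (fun s : ℝ => C * |s - t| / (δ / 4)) (𝓝 t) (𝓝 0) := by
      have h : Continuous fun s : ℝ => C * |s - t| / (δ / 4) := by fun_prop
      simpa using h.tendsto t
    exact squeeze_zero' (.of_forall fun _ => norm_nonneg _) hbound h
  have hG := hasDerivAt_cauchyG ρ (hpos t ht)
  have hds : Tendsto (fun s => dslope (cauchyG ρ) (w t) (w s)) (𝓝 t)
      (𝓝 (-∫ x : ℝ, ((w t - (x : ℂ)) ^ 2)⁻¹ ∂ρ)) := by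
    have h := (continuousAt_dslope_same.2 hG.differentiableAt).tendsto
    rw [dslope_same, hG.deriv] at h
    exact h.comp hcont
  have hden : Tendsto (fun s => 1 + γ * t * dslope (cauchyG ρ) (w t) (w s)) (𝓝 t)
      (𝓝 (1 + γ * t * -∫ x : ℝ, ((w t - (x : ℂ)) ^ 2)⁻¹ ∂ρ)) :=
    (hds.const_mul _).const_add _
  have hne : 1 + (γ : ℂ) * t * -∫ x : ℝ, ((w t - (x : ℂ)) ^ 2)⁻¹ ∂ρ ≠ 0 := by
    intro h
    have : (0 : ℂ) = 1 := by linear_combination hd - d * h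
    exact zero_ne_one this
  have hnum : Tendsto (fun s => -((β : ℂ) + γ * cauchyG ρ (w s))) (𝓝 t)
      (𝓝 (-((β : ℂ) + γ * cauchyG ρ (w t)))) :=
    (((hG.continuousAt.tendsto.comp hcont).const_mul _).const_add _).neg
  have hval : -((β : ℂ) + γ * cauchyG ρ (w t)) * d = -((β : ℂ) + γ * cauchyG ρ (w t)) /
      (1 + γ * t * -∫ x : ℝ, ((w t - (x : ℂ)) ^ 2)⁻¹ ∂ρ) := by
    rw [eq_div_iff hne]
    linear_combination -((β : ℂ) + γ * cauchyG ρ (w t)) * hd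
  rw [hasDerivAt_iff_tendsto_slope, hval]
  refine ((hnum.div hden hne).mono_left nhdsWithin_le_nhds).congr' ?_
  filter_upwards [self_mem_nhdsWithin, nhdsWithin_le_nhds (lt_mem_nhds ht),
    nhdsWithin_le_nhds (hden.eventually_ne hne)] with s hst hs hsne
  have h1 := hdiff s hs
  have h2 : cauchyG ρ (w s) - cauchyG ρ (w t) =
      (w s - w t) * dslope (cauchyG ρ) (w t) (w s) := by
    rw [← smul_eq_mul, sub_smul_dslope]
  have hst' : ((s - t : ℝ) : ℂ) ≠ 0 := ofReal_ne_zero.2 (sub_ne_zero.2 hst)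
  rw [h2] at h1
  rw [slope, vsub_eq_sub, real_smul, ofReal_inv, Pi.div_apply, div_eq_iff hsne]
  field_simp
  linear_combination -h1

lemma cauchyG_ne_zero (μ : Measure ℝ) [IsProbabilityMeasure μ] {z : ℂ} (hz : 0 < z.im) :
    cauchyG μ z ≠ 0 := by
  intro h
  have h1 := cauchyG_im μ hz
  have h2 : 0 < ∫ x : ℝ, ‖(z - (x : ℂ))⁻¹‖ ^ 2 ∂μ := by
    rw [integral_pos_iff_support_of_nonneg (fun x => by positivity)
      (integrable_norm_inv_sub_ofReal_sq μ hz)]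
    have : Function.support (fun x : ℝ => ‖(z - (x : ℂ))⁻¹‖ ^ 2) = Set.univ :=
      Set.eq_univ_of_forall fun x => by simpa using sub_ofReal_ne_zero hz.ne' x
    rw [this, measure_univ]
    exact one_pos
  rw [h, zero_im] at h1
  have := mul_pos hz h2
  linarith

lemma hasDerivAt_Ftr (μ : Measure ℝ) [IsProbabilityMeasure μ] {z : ℂ} (hz : 0 < z.im) :
    HasDerivAt (Ftr μ) ((∫ x : ℝ, ((z - (x : ℂ)) ^ 2)⁻¹ ∂μ) * Ftr μ z ^ 2) z := by
  have h := (hasDerivAt_cauchyG μ hz).fun_inv (cauchyG_ne_zero μ hz)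
  rw [neg_neg, div_eq_mul_inv, ← inv_pow] at h
  exact h

lemma im_le_im_Ftr {μ ν : Measure ℝ} [IsFiniteMeasure ν] {b c : ℝ} (hc : 0 ≤ c)
    (hν : ∀ z ∈ UHP, Ftr μ z = z - (b : ℂ) - (c : ℂ) * cauchyG ν z) {z : ℂ} (hz : 0 < z.im) :
    z.im ≤ (Ftr μ z).im := by
  rw [hν z hz, sub_im, sub_im, ofReal_im, im_ofReal_mul, cauchyG_im ν hz]
  have : 0 ≤ ∫ x : ℝ, ‖(z - (x : ℂ))⁻¹‖ ^ 2 ∂ν := integral_nonneg fun x => by positivity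
  have := mul_nonneg hc (mul_nonneg hz.le this)
  linarith

/-- If `b + c G_ρ` is a two-state Voiculescu transform of `(μt, μ)` and `ν` is the measure
`J[μt]`, then `ν` is subordinate to `ρ` with respect to `F_μ`. -/
lemma cauchyG_eq_of_isTwoStateVT {μt μ ρ ν : Measure ℝ} [IsProbabilityMeasure μ]
    [IsFiniteMeasure ρ] [IsFiniteMeasure ν] {b c : ℝ} (hc : c ≠ 0)
    (hVT : IsTwoStateVT μt μ (fun z => (b : ℂ) + (c : ℂ) * cauchyG ρ z))
    (hν : ∀ z ∈ UHP, Ftr μt z = z - (b : ℂ) - (c : ℂ) * cauchyG ν z)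
    (him : ∀ z : ℂ, 0 < z.im → z.im ≤ (Ftr μ z).im) :
    Set.EqOn (cauchyG ν) (fun z => cauchyG ρ (Ftr μ z)) UHP := by
  obtain ⟨α, M, hα, hM, h⟩ := hVT
  refine eqOn_UHP_of_eqOn_tcone
    (fun z hz => (hasDerivAt_cauchyG ν hz).differentiableAt.differentiableWithinAt)
    (fun z hz => ((hasDerivAt_cauchyG ρ (hz.trans_le (him z hz))).comp z
      (hasDerivAt_Ftr μ hz)).differentiableAt.differentiableWithinAt) hα hM fun z hz => ?_
  have h1 := h z hz
  rw [hν z (hM.trans hz.2)] at h1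
  refine mul_left_cancel₀ (ofReal_ne_zero.2 hc) ?_
  simp only at h1
  linear_combination -h1

lemma integral_inv_sq_sub_conj (μ : Measure ℝ) (z : ℂ) :
    ∫ x : ℝ, ((conj z - (x : ℂ)) ^ 2)⁻¹ ∂μ = conj (∫ x : ℝ, ((z - (x : ℂ)) ^ 2)⁻¹ ∂μ) := by
  rw [← integral_conj]
  simp

lemma hasDerivAt_cauchyG_conj {μ : ℝ → Measure ℝ} {z d : ℂ} {t : ℝ}
    (h : HasDerivAt (fun s => cauchyG (μ s) (conj z)) (conj d) t) :
    HasDerivAt (fun s => cauchyG (μ s) z) d t := by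
  have h' := h.star
  simpa [cauchyG_conj] using h'

/-- The relation between the `z`-derivatives of `F_{μt}` and `F_μ` obtained from
`F_{μt} = z - b - c G_ρ(F_μ)`. -/
lemma deriv_Ftr_of_subordination {μt μ ρ : Measure ℝ} [IsProbabilityMeasure μt]
    [IsProbabilityMeasure μ] [IsFiniteMeasure ρ] {b c : ℝ}
    (h : ∀ z ∈ UHP, Ftr μt z = z - (b : ℂ) - (c : ℂ) * cauchyG ρ (Ftr μ z))
    {z : ℂ} (hz : 0 < z.im) (hF : 0 < (Ftr μ z).im) :
    (∫ x : ℝ, ((z - (x : ℂ)) ^ 2)⁻¹ ∂μt) * Ftr μt z ^ 2 =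
      1 + c * ((∫ x : ℝ, ((Ftr μ z - (x : ℂ)) ^ 2)⁻¹ ∂ρ) *
        ((∫ x : ℝ, ((z - (x : ℂ)) ^ 2)⁻¹ ∂μ) * Ftr μ z ^ 2)) := by
  have h1 := ((hasDerivAt_id z).sub_const (b : ℂ)).sub
    (((hasDerivAt_cauchyG ρ hF).comp z (hasDerivAt_Ftr μ hz)).const_mul (c : ℂ))
  have h2 := (hasDerivAt_Ftr μt hz).congr_of_eventuallyEq
    (f₁ := fun z => z - (b : ℂ) - (c : ℂ) * cauchyG ρ (Ftr μ z))
    (by filter_upwards [isOpen_UHP.mem_nhds hz] with w hw using (h w hw).symm)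
  rw [h2.unique h1]
  ring

lemma hasDerivAt_cauchyG_of_Ftr {μ : ℝ → Measure ℝ} {z d : ℂ} {t : ℝ}
    (h : HasDerivAt (fun s => Ftr (μ s) z) d t) (hne : Ftr (μ t) z ≠ 0) :
    HasDerivAt (fun s => cauchyG (μ s) z) (-d * cauchyG (μ t) z ^ 2) t := by
  have h' := h.fun_inv hne
  simp only [Ftr, inv_inv, inv_pow, div_inv_eq_mul] at h'
  exact h'

/-- Generators of a two-state free convolution semigroup with finite
variance. For `f(x) = 1/(z−x)` the difference quotients are computed explicitly:
`∂f(x,y) = 1/((z−x)(z−y))`, `∂²f(x,y,w) = 1/((z−x)(z−y)(z−w))`,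
`∂_x[∂f(x,w)] = 1/((z−x)²(z−w))`, `f′(x) = 1/(z−x)²`. With `ν t = J[μ t]`,
`tν t = J[tμ t]`, the stated generator formulas hold for `d/dt ∫ f dtμ_t` and
`d/dt ∫ f dμ_t`. -/
theorem stmt16
    (β γ tβ tγ : ℝ) (hγ : 0 < γ) (htγ : 0 < tγ)
    (ρ tρ : Measure ℝ) (hρ : IsProbabilityMeasure ρ) (htρ : IsProbabilityMeasure tρ)
    (μ tμ : ℝ → Measure ℝ)
    (hprob : ∀ t : ℝ, 0 ≤ t → IsProbabilityMeasure (μ t) ∧ IsProbabilityMeasure (tμ t))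
    (hVT : ∀ t : ℝ, 0 ≤ t → IsVT (μ t)
      (fun z => ((β * t : ℝ) : ℂ) + ((γ * t : ℝ) : ℂ) * cauchyG ρ z))
    (h2VT : ∀ t : ℝ, 0 ≤ t → IsTwoStateVT (tμ t) (μ t)
      (fun z => ((tβ * t : ℝ) : ℂ) + ((tγ * t : ℝ) : ℂ) * cauchyG tρ z))
    (ν tν : ℝ → Measure ℝ)
    (hν : ∀ t : ℝ, 0 < t → IsProbabilityMeasure (ν t) ∧
      ∀ z ∈ UHP, Ftr (μ t) z =
        z - ((β * t : ℝ) : ℂ) - ((γ * t : ℝ) : ℂ) * cauchyG (ν t) z)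
    (htν : ∀ t : ℝ, 0 < t → IsProbabilityMeasure (tν t) ∧
      ∀ z ∈ UHP, Ftr (tμ t) z =
        z - ((tβ * t : ℝ) : ℂ) - ((tγ * t : ℝ) : ℂ) * cauchyG (tν t) z) :
    ∀ t : ℝ, 0 < t → ∀ z : ℂ, z.im ≠ 0 →
      HasDerivAt (fun s : ℝ => ∫ x : ℝ, (z - (x : ℂ))⁻¹ ∂(tμ s))
        ((tγ : ℂ) * (∫ x : ℝ, (∫ y : ℝ, (∫ w : ℝ,
            ((z - (x : ℂ)) * (z - (y : ℂ)) * (z - (w : ℂ)))⁻¹ ∂(tν t)) ∂(tμ t)) ∂(tμ t))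
          - (γ : ℂ) * (∫ x : ℝ, (∫ y : ℝ, (∫ w : ℝ,
            ((z - (x : ℂ)) * (z - (y : ℂ)) * (z - (w : ℂ)))⁻¹ ∂(ν t)) ∂(tμ t)) ∂(tμ t))
          + ((tβ - β : ℝ) : ℂ) * (∫ x : ℝ, (∫ y : ℝ,
            ((z - (x : ℂ)) * (z - (y : ℂ)))⁻¹ ∂(tμ t)) ∂(tμ t))
          + (γ : ℂ) * (∫ x : ℝ, (∫ w : ℝ,
            ((z - (x : ℂ)) ^ 2 * (z - (w : ℂ)))⁻¹ ∂(ν t)) ∂(tμ t))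
          + (β : ℂ) * (∫ x : ℝ, ((z - (x : ℂ)) ^ 2)⁻¹ ∂(tμ t))) t ∧
      HasDerivAt (fun s : ℝ => ∫ x : ℝ, (z - (x : ℂ))⁻¹ ∂(μ s))
        ((γ : ℂ) * (∫ x : ℝ, (∫ w : ℝ,
            ((z - (x : ℂ)) ^ 2 * (z - (w : ℂ)))⁻¹ ∂(ν t)) ∂(μ t))
          + (β : ℂ) * (∫ x : ℝ, ((z - (x : ℂ)) ^ 2)⁻¹ ∂(μ t))) t := by
  intro t ht z hz
  have hμ : ∀ s, 0 < s → IsProbabilityMeasure (μ s) := fun s hs => (hprob s hs.le).1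
  have htμ : ∀ s, 0 < s → IsProbabilityMeasure (tμ s) := fun s hs => (hprob s hs.le).2
  simp only [mul_inv, integral_const_mul, integral_mul_const]
  change HasDerivAt (fun s : ℝ => cauchyG (tμ s) z)
      ((tγ : ℂ) * (cauchyG (tμ t) z * cauchyG (tμ t) z * cauchyG (tν t) z) -
        γ * (cauchyG (tμ t) z * cauchyG (tμ t) z * cauchyG (ν t) z) +
        ((tβ - β : ℝ) : ℂ) * (cauchyG (tμ t) z * cauchyG (tμ t) z) +
        γ * ((∫ x : ℝ, ((z - (x : ℂ)) ^ 2)⁻¹ ∂(tμ t)) * cauchyG (ν t) z) +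
        β * (∫ x : ℝ, ((z - (x : ℂ)) ^ 2)⁻¹ ∂(tμ t))) t ∧
    HasDerivAt (fun s : ℝ => cauchyG (μ s) z)
      (γ * ((∫ x : ℝ, ((z - (x : ℂ)) ^ 2)⁻¹ ∂(μ t)) * cauchyG (ν t) z) +
        β * (∫ x : ℝ, ((z - (x : ℂ)) ^ 2)⁻¹ ∂(μ t))) t
  wlog hzpos : 0 < z.im generalizing z
  · have h := this (conj z) (by simpa using hz)
      (by simpa using lt_of_le_of_ne (not_lt.1 hzpos) hz)
    refine ⟨hasDerivAt_cauchyG_conj ?_, hasDerivAt_cauchyG_conj ?_⟩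
    · simpa only [map_add, map_sub, map_mul, conj_ofReal, ← cauchyG_conj,
        ← integral_inv_sq_sub_conj] using h.1
    · simpa only [map_add, map_sub, map_mul, conj_ofReal, ← cauchyG_conj,
        ← integral_inv_sq_sub_conj] using h.2
  have him : ∀ s, 0 < s → ∀ z : ℂ, 0 < z.im → z.im ≤ (Ftr (μ s) z).im := fun s hs z hz =>
    have := (hν s hs).1
    im_le_im_Ftr (mul_pos hγ hs).le (hν s hs).2 hz
  have hsub : ∀ s, 0 < s → ∀ z ∈ UHP, cauchyG (ν s) z = cauchyG ρ (Ftr (μ s) z) :=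
    fun s hs =>
      have := (hν s hs).1
      have := hμ s hs
      cauchyG_eq_of_isTwoStateVT (mul_pos hγ hs).ne' (hVT s hs.le) (hν s hs).2 (him s hs)
  have htsub : ∀ s, 0 < s → ∀ z ∈ UHP, cauchyG (tν s) z = cauchyG tρ (Ftr (μ s) z) :=
    fun s hs =>
      have := (htν s hs).1
      have := hμ s hs
      cauchyG_eq_of_isTwoStateVT (mul_pos htγ hs).ne' (h2VT s hs.le) (htν s hs).2 (him s hs)
  have hF : ∀ s, 0 < s → ∀ z ∈ UHP, Ftr (μ s) z =
      z - ((β * s : ℝ) : ℂ) - ((γ * s : ℝ) : ℂ) * cauchyG ρ (Ftr (μ s) z) := fun s hs z hz => by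
    rw [← hsub s hs z hz]
    exact (hν s hs).2 z hz
  have htF : ∀ s, 0 < s → ∀ z ∈ UHP, Ftr (tμ s) z =
      z - ((tβ * s : ℝ) : ℂ) - ((tγ * s : ℝ) : ℂ) * cauchyG tρ (Ftr (μ s) z) :=
    fun s hs z hz => by
      rw [← htsub s hs z hz]
      exact (htν s hs).2 z hz
  have := hμ t ht
  have := htμ t ht
  have hwpos : 0 < (Ftr (μ t) z).im := hzpos.trans_le (him t ht z hzpos)
  have hD := deriv_Ftr_of_subordination (hF t ht) hzpos hwpos
  have htD := deriv_Ftr_of_subordination (htF t ht) hzpos hwpos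
  have hG : Ftr (μ t) z * cauchyG (μ t) z = 1 := inv_mul_cancel₀ (cauchyG_ne_zero _ hzpos)
  have htG : Ftr (tμ t) z * cauchyG (tμ t) z = 1 := inv_mul_cancel₀ (cauchyG_ne_zero _ hzpos)
  rw [hsub t ht z hzpos, htsub t ht z hzpos]
  have hw := hasDerivAt_of_subordination ρ hγ ht hzpos (w := fun s => Ftr (μ s) z)
    (fun s hs => him s hs z hzpos) (fun s hs => hF s hs z hzpos)
    (d := (∫ x : ℝ, ((z - (x : ℂ)) ^ 2)⁻¹ ∂(μ t)) * Ftr (μ t) z ^ 2)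
    (by push_cast at hD; linear_combination hD)
  constructor
  · have h0 := (hasDerivAt_cauchyG tρ hwpos).comp (h := fun s => Ftr (μ s) z) t hw
    have h1 : HasDerivAt (fun s : ℝ => z - ((tβ * s : ℝ) : ℂ) -
        ((tγ * s : ℝ) : ℂ) * cauchyG tρ (Ftr (μ s) z)) _ t :=
      ((((hasDerivAt_id t).const_mul tβ).ofReal_comp).const_sub z).sub
        ((((hasDerivAt_id t).const_mul tγ).ofReal_comp).mul h0)
    have h2 := h1.congr_of_eventuallyEq (f₁ := fun s => Ftr (tμ s) z)
      (by filter_upwards [lt_mem_nhds ht] with s hs using htF s hs z hzpos)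
    refine (hasDerivAt_cauchyG_of_Ftr h2 (left_ne_zero_of_mul_eq_one htG)).congr_deriv ?_
    simp only [id, mul_one]
    push_cast at htD ⊢
    generalize cauchyG (tμ t) z = g at *
    generalize Ftr (tμ t) z = f at *
    linear_combination (β + γ * cauchyG ρ (Ftr (μ t) z)) * (-g ^ 2 * htD +
      (∫ x : ℝ, ((z - (x : ℂ)) ^ 2)⁻¹ ∂(tμ t)) * (f * g + 1) * htG)
  · refine (hasDerivAt_cauchyG_of_Ftr hw (left_ne_zero_of_mul_eq_one hG)).congr_deriv ?_
    linear_combination (β + γ * cauchyG ρ (Ftr (μ t) z)) *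
      (∫ x : ℝ, ((z - (x : ℂ)) ^ 2)⁻¹ ∂(μ t)) * (Ftr (μ t) z * cauchyG (μ t) z + 1) * hG
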